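/- arXiv:1805.05077 — 4 statements merged into one kernel-verified Lean document; each statement's English description precedes it below -/
import Mathlib

section
/- For every A ≥ 0 and every φ ∈ Ĉ_A, the function 𝒟φ belongs to C_A. That is: 𝒟φ is continuous, nondecreasing and nonnegative on [0,∞); it satisfies (ℐ(𝒟φ)(x))⁺ ≤ 𝒟φ(x) ≤ x + A for all x ≥ 0 and 𝒟φ(0) = (ℐ(𝒟φ)(0))⁺; and the map x ↦ 𝒟φ(x) − x is nondecreasing and bounded by A on [0,∞). -/
open Set

/-- Issuance cost function: `c ζ = λ_f + (1 + λ_p) ζ` for `ζ > 0`, `c 0 = 0`. -/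
noncomputable def cost (lf lp ζ : ℝ) : ℝ := if 0 < ζ then lf + (1 + lp) * ζ else 0

/-- Dividend operator `𝒟φ(x) = sup_{0 ≤ ℓ ≤ x} (φ(x − ℓ) + ℓ)`. -/
noncomputable def Dop (φ : ℝ → ℝ) (x : ℝ) : ℝ :=
  sSup ((fun ℓ => φ (x - ℓ) + ℓ) '' Set.Icc 0 x)

/-- Issuance operator `ℐ(φ)(x) = sup_{ζ > 0} (φ(x + ζ) − c(ζ))`. -/
noncomputable def Iop (lf lp : ℝ) (φ : ℝ → ℝ) (x : ℝ) : ℝ :=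
  sSup ((fun ζ => φ (x + ζ) - cost lf lp ζ) '' Set.Ioi 0)

/-- Membership in the class `Ĉ_A`. -/
def MemChat (lf lp A : ℝ) (φ : ℝ → ℝ) : Prop :=
  ContinuousOn φ (Set.Ici 0) ∧ MonotoneOn φ (Set.Ici 0) ∧
    (∀ x, 0 ≤ x → 0 ≤ φ x) ∧
    (∀ x, 0 ≤ x → max (Iop lf lp φ x) 0 ≤ φ x ∧ φ x ≤ x + A) ∧
    φ 0 = max (Iop lf lp φ 0) 0

/-- Membership in the class `C_A`. -/
def MemC (lf lp A : ℝ) (φ : ℝ → ℝ) : Prop :=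
  MemChat lf lp A φ ∧ MonotoneOn (fun x => φ x - x) (Set.Ici 0) ∧
    ∀ x, 0 ≤ x → φ x - x ≤ A

theorem cost_of_pos {lf lp ζ : ℝ} (hζ : 0 < ζ) : cost lf lp ζ = lf + (1 + lp) * ζ :=
  if_pos hζ

section Dividend

variable {φ : ℝ → ℝ} {A x y b : ℝ}

theorem bddAbove_dividend (hA : ∀ x, 0 ≤ x → φ x ≤ x + A) (x : ℝ) :
    BddAbove ((fun ℓ => φ (x - ℓ) + ℓ) '' Icc 0 x) := by
  refine ⟨x + A, ?_⟩
  rintro _ ⟨ℓ, hℓ, rfl⟩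
  have := hA (x - ℓ) (by linarith [hℓ.2])
  dsimp only
  linarith

theorem add_sub_le_Dop (hA : ∀ x, 0 ≤ x → φ x ≤ x + A) (hy : 0 ≤ y) (hyx : y ≤ x) :
    φ y + (x - y) ≤ Dop φ x :=
  le_csSup (bddAbove_dividend hA x) ⟨x - y, ⟨by linarith, by linarith⟩, by simp⟩

theorem le_Dop (hA : ∀ x, 0 ≤ x → φ x ≤ x + A) (hx : 0 ≤ x) : φ x ≤ Dop φ x := by
  simpa using add_sub_le_Dop hA hx le_rfl

theorem Dop_le (hx : 0 ≤ x) (h : ∀ y, 0 ≤ y → y ≤ x → φ y + (x - y) ≤ b) : Dop φ x ≤ b := by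
  refine csSup_le ((nonempty_Icc.2 hx).image _) ?_
  rintro _ ⟨ℓ, hℓ, rfl⟩
  have := h (x - ℓ) (by linarith [hℓ.2]) (by linarith [hℓ.1])
  dsimp only
  linarith

theorem Dop_le_add (hA : ∀ x, 0 ≤ x → φ x ≤ x + A) (hx : 0 ≤ x) : Dop φ x ≤ x + A :=
  Dop_le hx fun y hy _ => by linarith [hA y hy]

theorem Dop_zero : Dop φ 0 = φ 0 := by simp [Dop]

theorem monotoneOn_Dop_sub (hA : ∀ x, 0 ≤ x → φ x ≤ x + A) :
    MonotoneOn (fun x => Dop φ x - x) (Ici 0) := by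
  intro x hx x' _ hxx'
  have : Dop φ x ≤ Dop φ x' - x' + x := Dop_le hx fun y hy hyx => by
    linarith [add_sub_le_Dop hA hy (hyx.trans hxx')]
  dsimp only
  linarith

theorem monotoneOn_Dop (hA : ∀ x, 0 ≤ x → φ x ≤ x + A) : MonotoneOn (Dop φ) (Ici 0) := by
  intro x hx x' hx' hxx'
  have : Dop φ x - x ≤ Dop φ x' - x' := monotoneOn_Dop_sub hA hx hx' hxx'
  linarith

/-- The supremum defining `Dop φ x`, rescaled to the fixed compact interval `[0, 1]`. -/
theorem Dop_eq_sSup_image_unitInterval (hx : 0 ≤ x) :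
    Dop φ x = sSup ((fun t => φ (max (x - x * t) 0) + x * t) '' Icc 0 1) := by
  have hIcc : Icc 0 x = (fun t => x * t) '' Icc 0 1 := by
    rw [image_mul_left_Icc hx zero_le_one, mul_zero, mul_one]
  rw [Dop, hIcc, image_image]
  congr 1
  refine image_congr fun t ht => ?_
  rw [max_eq_left]
  nlinarith [ht.2]

theorem continuousOn_Dop (hφ : ContinuousOn φ (Ici 0)) : ContinuousOn (Dop φ) (Ici 0) := by
  have hψ : Continuous fun z => φ (max z 0) :=
    hφ.comp_continuous (by fun_prop) fun z => le_max_right z 0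
  have hcont : Continuous fun x : ℝ =>
      sSup ((fun t => φ (max (x - x * t) 0) + x * t) '' Icc (0 : ℝ) 1) := by
    refine isCompact_Icc.continuous_sSup (f := fun x t => φ (max (x - x * t) 0) + x * t) ?_
    exact (hψ.comp (g := fun z => φ (max z 0)) (f := fun p : ℝ × ℝ => p.1 - p.1 * p.2)
      (by fun_prop)).add (by fun_prop)
  exact hcont.continuousOn.congr fun x hx => Dop_eq_sSup_image_unitInterval hx

end Dividend

section Issuance

variable {lf lp A x ζ b : ℝ} {φ ψ : ℝ → ℝ}

theorem bddAbove_issuance (hlf : 0 ≤ lf) (hlp : 0 ≤ lp) (hA : ∀ x, 0 ≤ x → φ x ≤ x + A)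
    (hx : 0 ≤ x) : BddAbove ((fun ζ => φ (x + ζ) - cost lf lp ζ) '' Ioi 0) := by
  refine ⟨x + A, ?_⟩
  rintro _ ⟨ζ, hζ : 0 < ζ, rfl⟩
  have := hA (x + ζ) (by linarith)
  have := mul_nonneg hlp hζ.le
  simp only [cost_of_pos hζ]
  linarith

theorem sub_cost_le_Iop (hlf : 0 ≤ lf) (hlp : 0 ≤ lp) (hA : ∀ x, 0 ≤ x → φ x ≤ x + A)
    (hx : 0 ≤ x) (hζ : 0 < ζ) : φ (x + ζ) - cost lf lp ζ ≤ Iop lf lp φ x :=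
  le_csSup (bddAbove_issuance hlf hlp hA hx) ⟨ζ, hζ, rfl⟩

theorem Iop_le (h : ∀ ζ, 0 < ζ → φ (x + ζ) - cost lf lp ζ ≤ b) : Iop lf lp φ x ≤ b := by
  refine csSup_le (nonempty_Ioi.image _) ?_
  rintro _ ⟨ζ, hζ, rfl⟩
  exact h ζ hζ

theorem Iop_mono (hlf : 0 ≤ lf) (hlp : 0 ≤ lp) (hA : ∀ x, 0 ≤ x → ψ x ≤ x + A)
    (hφψ : ∀ x, 0 ≤ x → φ x ≤ ψ x) (hx : 0 ≤ x) : Iop lf lp φ x ≤ Iop lf lp ψ x :=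
  Iop_le fun ζ hζ => (sub_le_sub_right (hφψ (x + ζ) (by linarith)) _).trans
    (sub_cost_le_Iop hlf hlp hA hx hζ)

theorem Iop_Dop_le (hlf : 0 ≤ lf) (hlp : 0 ≤ lp) (hA : ∀ x, 0 ≤ x → φ x ≤ x + A)
    (hx : 0 ≤ x) (hI : Iop lf lp φ x ≤ φ x) : Iop lf lp (Dop φ) x ≤ Dop φ x := by
  refine Iop_le fun ζ hζ => sub_le_iff_le_add.2 (Dop_le (by linarith) fun y hy hyx => ?_)
  rw [cost_of_pos hζ]
  rcases le_or_gt y x with hyx' | hxy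
  · have := add_sub_le_Dop hA hy hyx'
    have := mul_nonneg hlp hζ.le
    linarith
  · have hissue := sub_cost_le_Iop hlf hlp hA hx (sub_pos.2 hxy)
    rw [cost_of_pos (sub_pos.2 hxy), add_sub_cancel] at hissue
    have := le_Dop hA hx
    have := mul_le_mul_of_nonneg_left (show y - x ≤ ζ by linarith) hlp
    linarith

end Issuance

/-- For every `A ≥ 0` and every `φ ∈ Ĉ_A`, the function `𝒟φ` belongs to `C_A`. -/
theorem Dop_mem_C (lf lp A : ℝ) (hlf : 0 < lf) (hlp : 0 < lp) (hA : 0 ≤ A)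
    (φ : ℝ → ℝ) (hφ : MemChat lf lp A φ) :
    MemC lf lp A (Dop φ) := by
  obtain ⟨hcont, -, hnonneg, hbd, hzero⟩ := hφ
  have hle : ∀ x, 0 ≤ x → φ x ≤ x + A := fun x hx => (hbd x hx).2
  have hD : ∀ x, 0 ≤ x → Dop φ x ≤ x + A := fun x hx => Dop_le_add hle hx
  have hD0 : ∀ x, 0 ≤ x → 0 ≤ Dop φ x := fun x hx => (hnonneg x hx).trans (le_Dop hle hx)
  have hID : ∀ x, 0 ≤ x → max (Iop lf lp (Dop φ) x) 0 ≤ Dop φ x := fun x hx =>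
    max_le (Iop_Dop_le hlf.le hlp.le hle hx ((le_max_left _ _).trans (hbd x hx).1)) (hD0 x hx)
  refine ⟨⟨continuousOn_Dop hcont, monotoneOn_Dop hle, hD0, fun x hx => ⟨hID x hx, hD x hx⟩,
    le_antisymm ?_ (hID 0 le_rfl)⟩, monotoneOn_Dop_sub hle, fun x hx => by linarith [hD x hx]⟩
  rw [Dop_zero, hzero]
  exact max_le_max_right 0
    (Iop_mono hlf.le hlp.le hD (fun x hx => le_Dop hle hx) le_rfl)
end

section
/- Let φ : [0,∞) → [0,∞) be continuous and satisfy φ(x + ζ) ≤ φ(x) + c(ζ) for all x ≥ 0 and ζ > 0. Then 𝒟φ(x + ζ) ≤ 𝒟φ(x) + c(ζ) for all x ≥ 0 and ζ > 0; consequently 𝒟φ(x) ≥ (ℐ(𝒟φ)(x))⁺ for every x ≥ 0. -/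
open Set

/-- Every admissible dividend is bounded by the dividend operator. -/
theorem le_Dop_s1 {φ : ℝ → ℝ} (hcont : ContinuousOn φ (Set.Ici 0)) {x ℓ : ℝ}
    (hℓ : ℓ ∈ Set.Icc 0 x) : φ (x - ℓ) + ℓ ≤ Dop φ x := by
  have hcomp : ContinuousOn (fun ℓ => φ (x - ℓ) + ℓ) (Set.Icc 0 x) :=
    (hcont.comp (by fun_prop) fun m hm => sub_nonneg.2 hm.2).add continuousOn_id
  exact le_csSup (isCompact_Icc.bddAbove_image hcomp) (Set.mem_image_of_mem _ hℓ)

/-- The dividend operator preserves the growth bound by the issuance cost. -/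
theorem Dop_add_le {lf lp : ℝ} (hlf : 0 ≤ lf) (hlp : 0 ≤ lp) {φ : ℝ → ℝ}
    (hcont : ContinuousOn φ (Set.Ici 0))
    (hsub : ∀ x, 0 ≤ x → ∀ ζ, 0 < ζ → φ (x + ζ) ≤ φ x + cost lf lp ζ)
    {x ζ : ℝ} (hx : 0 ≤ x) (hζ : 0 < ζ) :
    Dop φ (x + ζ) ≤ Dop φ x + cost lf lp ζ := by
  refine csSup_le ((Set.nonempty_Icc.2 (by linarith)).image _) ?_
  rintro _ ⟨ℓ, ⟨h0, h1⟩, rfl⟩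
  dsimp only
  rcases le_or_gt ℓ x with h | h
  · have hD := le_Dop_s1 hcont ⟨h0, h⟩
    have hφ := hsub (x - ℓ) (by linarith) ζ hζ
    rw [sub_add_eq_add_sub] at hφ
    linarith
  · have hD := le_Dop_s1 hcont (Set.right_mem_Icc.2 hx)
    rw [sub_self] at hD
    have hc : cost lf lp ζ = lf + (1 + lp) * ζ := if_pos hζ
    rcases h1.eq_or_lt with rfl | h1
    · rw [sub_self]
      nlinarith [mul_nonneg hlp hζ.le]
    · have hy : 0 < x + ζ - ℓ := by linarith
      have hφ := hsub 0 le_rfl _ hy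
      have hcy : cost lf lp (x + ζ - ℓ) = lf + (1 + lp) * (x + ζ - ℓ) := if_pos hy
      rw [zero_add] at hφ
      nlinarith [mul_nonneg hlp (sub_nonneg.2 h.le)]

/-- If `φ : [0,∞) → [0,∞)` is continuous and satisfies `φ(x+ζ) ≤ φ(x) + c(ζ)` for all
`x ≥ 0`, `ζ > 0`, then `𝒟φ(x+ζ) ≤ 𝒟φ(x) + c(ζ)`, and consequently
`𝒟φ(x) ≥ (ℐ(𝒟φ)(x))⁺` for every `x ≥ 0`. -/
theorem Dop_cost_subadd (lf lp : ℝ) (hlf : 0 < lf) (hlp : 0 < lp)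
    (φ : ℝ → ℝ) (hcont : ContinuousOn φ (Set.Ici 0))
    (hnonneg : ∀ x, 0 ≤ x → 0 ≤ φ x)
    (hsub : ∀ x, 0 ≤ x → ∀ ζ, 0 < ζ → φ (x + ζ) ≤ φ x + cost lf lp ζ) :
    (∀ x, 0 ≤ x → ∀ ζ, 0 < ζ → Dop φ (x + ζ) ≤ Dop φ x + cost lf lp ζ) ∧
    (∀ x, 0 ≤ x → max (Iop lf lp (Dop φ) x) 0 ≤ Dop φ x) := by
  have hD : ∀ x, 0 ≤ x → ∀ ζ, 0 < ζ → Dop φ (x + ζ) ≤ Dop φ x + cost lf lp ζ :=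
    fun x hx ζ hζ => Dop_add_le hlf.le hlp.le hcont hsub hx hζ
  refine ⟨hD, fun x hx => max_le ?_ ?_⟩
  · refine csSup_le (Set.nonempty_Ioi.image _) ?_
    rintro _ ⟨ζ, hζ, rfl⟩
    exact sub_le_iff_le_add.2 (hD x hx ζ hζ)
  · have h := le_Dop_s1 hcont (Set.left_mem_Icc.2 hx)
    rw [sub_zero, add_zero] at h
    exact (hnonneg x hx).trans h
end

section
/- Let A ≥ 0 and let φ : [0,∞) → [0,∞) be continuous with φ(x) ≤ x + A for all x ≥ 0. Assume φ(0) > 0 and φ(0) = ℐ(φ)(0) = sup_{ζ > 0} (φ(ζ) − c(ζ)). Then there exists ζ_* > 0 such that φ(0) = sup_{ζ ≥ ζ_*} (φ(ζ) − c(ζ)); that is, the supremum defining ℐ(φ)(0) is achieved in the limit only over issuance sizes bounded away from zero. -/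
open Set

/-- If `φ : [0,∞) → [0,∞)` is continuous with `φ(x) ≤ x + A`, `φ(0) > 0`, and
`φ(0) = ℐ(φ)(0) = sup_{ζ > 0} (φ(ζ) − c(ζ))`, then there exists `ζ_* > 0` such that
`φ(0) = sup_{ζ ≥ ζ_*} (φ(ζ) − c(ζ))`: the supremum defining `ℐ(φ)(0)` is achieved in the
limit only over issuance sizes bounded away from zero. -/
theorem Iop_zero_bounded_away (lf lp A : ℝ) (hlf : 0 < lf) (hlp : 0 < lp) (hA : 0 ≤ A)
    (φ : ℝ → ℝ) (hcont : ContinuousOn φ (Set.Ici 0))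
    (hnonneg : ∀ x, 0 ≤ x → 0 ≤ φ x)
    (hub : ∀ x, 0 ≤ x → φ x ≤ x + A)
    (hpos : 0 < φ 0)
    (heq : φ 0 = sSup ((fun ζ => φ (0 + ζ) - cost lf lp ζ) '' Set.Ioi 0)) :
    ∃ ζstar : ℝ, 0 < ζstar ∧
      φ 0 = sSup ((fun ζ => φ ζ - cost lf lp ζ) '' Set.Ici ζstar) := by
  set f : ℝ → ℝ := fun ζ => φ ζ - cost lf lp ζ with hf
  have hcost : ∀ ζ, 0 < ζ → f ζ = φ ζ - (lf + (1 + lp) * ζ) := fun ζ hζ => by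
    simp [hf, cost, hζ]
  have hbdd : BddAbove (f '' Ioi 0) := by
    refine ⟨A, ?_⟩
    rintro _ ⟨ζ, hζ, rfl⟩
    have hζ' : 0 < ζ := hζ
    rw [hcost ζ hζ']
    nlinarith [hub ζ hζ'.le, mul_pos hlp hζ']
  have hlub : IsLUB (f '' Ioi 0) (φ 0) := by
    have h := isLUB_csSup ((nonempty_Ioi (a := (0 : ℝ))).image f) hbdd
    simp only [zero_add] at heq
    rwa [← heq] at h
  -- near zero, the fixed cost keeps `f` below `φ 0` by a uniform margin
  obtain ⟨δ, hδ, hnear⟩ := Metric.continuousOn_iff.1 hcont 0 self_mem_Ici (lf / 2) (half_pos hlf)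
  have hsmall : ∀ ζ, 0 < ζ → ζ < δ → f ζ ≤ φ 0 - lf / 2 := fun ζ h0 h1 => by
    have h := hnear ζ h0.le (by rwa [Real.dist_eq, sub_zero, abs_of_pos h0])
    rw [Real.dist_eq] at h
    rw [hcost ζ h0]
    nlinarith [(abs_lt.1 h).2, mul_pos hlp h0]
  refine ⟨δ, hδ, (IsLUB.csSup_eq ⟨?_, fun b hb => ?_⟩ (nonempty_Ici.image f)).symm⟩
  · exact upperBounds_mono_set (image_mono (Ici_subset_Ioi.2 hδ)) hlub.1
  · have hmax : φ 0 ≤ max b (φ 0 - lf / 2) := by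
      refine hlub.2 ?_
      rintro _ ⟨ζ, hζ, rfl⟩
      rcases lt_or_ge ζ δ with h | h
      · exact le_max_of_le_right (hsmall ζ hζ h)
      · exact le_max_of_le_left (hb ⟨ζ, h, rfl⟩)
    exact (le_max_iff.1 hmax).resolve_right (by linarith)
end

section
/- Let m be a modulus with m(s) ≤ A for all s ≥ 0, and let μ ≥ 0 and σ ≥ 0. Define M(0) = 0 and, for t > 0, M(t) = ∫_ℝ m(μt + σ|y|) d(gaussianReal 0 t)(y). Then M is a modulus: M is nondecreasing on [0,∞), M(0) = 0, and M(t) → 0 as t → 0⁺. -/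
open MeasureTheory ProbabilityTheory Set

/-- Brownian scaling: the centered Gaussian of variance `t` is the law of `√t Z`, with `Z`
standard normal. -/
lemma gaussianReal_map_sqrt_mul {t : ℝ} (ht : 0 ≤ t) :
    (gaussianReal 0 1).map (fun z ↦ √t * z) = gaussianReal 0 t.toNNReal := by
  rw [gaussianReal_map_const_mul, mul_zero, mul_one]
  congr 1
  ext
  simp [Real.sq_sqrt ht, ht]

/-- A function that is monotone on `[0, ∞)`, precomposed with the positive part, is monotone. -/
lemma MonotoneOn.monotone_comp_max_zero {m : ℝ → ℝ} (hm : MonotoneOn m (Ici 0)) :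
    Monotone (fun s ↦ m (max s 0)) :=
  fun _ _ h ↦ hm (mem_Ici.2 (le_max_right _ _)) (mem_Ici.2 (le_max_right _ _))
    (max_le_max_right 0 h)

/-- Let `m` be a modulus (nondecreasing, nonnegative, `m 0 = 0`, continuous at `0` from the
right) bounded by `A`, and let `μ, σ ≥ 0`.  Define `M 0 = 0` and, for `t > 0`,
`M t = ∫ m(μ t + σ |y|) d(gaussianReal 0 t)(y)`.  Then `M` is a modulus: nondecreasing on
`[0,∞)`, nonnegative there, `M 0 = 0`, and `M t → 0` as `t → 0⁺`. -/
theorem gaussian_modulus (m : ℝ → ℝ) (A μ σ : ℝ)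
    (hmono : MonotoneOn m (Set.Ici 0))
    (hnonneg : ∀ s, 0 ≤ s → 0 ≤ m s)
    (hm0 : m 0 = 0)
    (hcont0 : Filter.Tendsto m (nhdsWithin 0 (Set.Ici 0)) (nhds 0))
    (hbdd : ∀ s, 0 ≤ s → m s ≤ A)
    (hμ : 0 ≤ μ) (hσ : 0 ≤ σ)
    (M : ℝ → ℝ)
    (hM : ∀ t : ℝ, M t =
      if 0 < t then ∫ y, m (μ * t + σ * |y|) ∂(gaussianReal 0 t.toNNReal) else 0) :
    MonotoneOn M (Set.Ici 0) ∧ (∀ t, 0 ≤ t → 0 ≤ M t) ∧ M 0 = 0 ∧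
      Filter.Tendsto M (nhdsWithin 0 (Set.Ioi 0)) (nhds 0) := by
  have hpos : ∀ t z : ℝ, 0 ≤ t → 0 ≤ μ * t + σ * (√t * |z|) := fun t z ht ↦ by positivity
  have hmeas : ∀ t : ℝ, 0 ≤ t → Measurable (fun y : ℝ ↦ m (μ * t + σ * |y|)) := fun t ht ↦ by
    have h : Measurable (fun y : ℝ ↦ m (max (μ * t + σ * |y|) 0)) :=
      hmono.monotone_comp_max_zero.measurable.comp (by fun_prop)
    convert h using 3 with y
    exact (max_eq_left (by positivity)).symm
  have hmeas_std : ∀ t : ℝ, 0 ≤ t → Measurable (fun z : ℝ ↦ m (μ * t + σ * (√t * |z|))) :=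
    fun t ht ↦ by
      have h := (hmeas t ht).comp (measurable_const_mul (√t))
      simpa only [Function.comp_def, abs_mul, abs_of_nonneg (Real.sqrt_nonneg t)] using h
  have hbound : ∀ t z : ℝ, 0 ≤ t → ‖m (μ * t + σ * (√t * |z|))‖ ≤ A := fun t z ht ↦ by
    rw [Real.norm_of_nonneg (hnonneg _ (hpos t z ht))]
    exact hbdd _ (hpos t z ht)
  have hint : ∀ t : ℝ, 0 ≤ t →
      Integrable (fun z : ℝ ↦ m (μ * t + σ * (√t * |z|))) (gaussianReal 0 1) := fun t ht ↦
    Integrable.of_bound (hmeas_std t ht).aestronglyMeasurable A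
      (Filter.Eventually.of_forall fun z ↦ hbound t z ht)
  have hM_std : ∀ t : ℝ, 0 ≤ t →
      M t = ∫ z, m (μ * t + σ * (√t * |z|)) ∂(gaussianReal 0 1) := fun t ht ↦ by
    rcases ht.eq_or_lt with rfl | h
    · simp [hM, hm0]
    · rw [hM, if_pos h, ← gaussianReal_map_sqrt_mul ht,
        integral_map (by fun_prop) (hmeas t ht).aestronglyMeasurable]
      simp only [abs_mul, abs_of_nonneg (Real.sqrt_nonneg t)]
  refine ⟨fun s hs t ht hst ↦ ?_, fun t ht ↦ ?_, by simp [hM], ?_⟩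
  · rw [mem_Ici] at hs ht
    rw [hM_std s hs, hM_std t ht]
    refine integral_mono (hint s hs) (hint t ht) fun z ↦ hmono (hpos s z hs) (hpos t z ht) ?_
    gcongr
  · rw [hM_std t ht]
    exact integral_nonneg fun z ↦ hnonneg _ (hpos t z ht)
  · have hev : ∀ᶠ t : ℝ in nhdsWithin 0 (Ioi 0), 0 ≤ t :=
      eventually_mem_nhdsWithin.mono fun t ht ↦ le_of_lt ht
    have hlim : Filter.Tendsto
        (fun t : ℝ ↦ ∫ z, m (μ * t + σ * (√t * |z|)) ∂(gaussianReal 0 1))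
        (nhdsWithin 0 (Ioi 0)) (nhds (∫ _, (0 : ℝ) ∂(gaussianReal 0 1))) := by
      refine tendsto_integral_filter_of_dominated_convergence (fun _ ↦ A)
        (hev.mono fun t ht ↦ (hmeas_std t ht).aestronglyMeasurable)
        (hev.mono fun t ht ↦ Filter.Eventually.of_forall fun z ↦ hbound t z ht)
        (integrable_const A) (Filter.Eventually.of_forall fun z ↦ hcont0.comp ?_)
      refine tendsto_nhdsWithin_iff.2 ⟨?_, hev.mono fun t ht ↦ hpos t z ht⟩
      have hc : Continuous fun t : ℝ ↦ μ * t + σ * (√t * |z|) := by fun_prop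
      simpa using (hc.tendsto 0).mono_left nhdsWithin_le_nhds
    rw [integral_zero] at hlim
    exact hlim.congr' (hev.mono fun t ht ↦ (hM_std t ht).symm)
end
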